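/- For every integer n, the following identities hold between the Tribonacci and Tribonacci-Lucas matrix sequences: (a) 𝒦_n = 3𝒯_{n+1} − 2𝒯_n − 𝒯_{n−1}; (b) 𝒦_n = 𝒯_n + 2𝒯_{n−1} + 3𝒯_{n−2}; (c) 𝒦_n = 4𝒯_{n+1} − 𝒯_n − 𝒯_{n+2}; (d) 22·𝒯_n = 5𝒦_{n+2} − 3𝒦_{n+1} − 4𝒦_n. -/

import Mathlib

theorem trib_zero (f : ℤ → ℤ) (hf : ∀ n : ℤ, f n = f (n - 1) + f (n - 2) + f (n - 3))
    (h0 : f 0 = 0) (h1 : f 1 = 0) (h2 : f 2 = 0) (n : ℤ) : f n = 0 := by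
  have key : ∀ n : ℤ, f n = 0 ∧ f (n + 1) = 0 ∧ f (n + 2) = 0 := by
    intro n
    induction n using Int.induction_on with
    | zero => exact ⟨h0, by simpa using h1, by simpa using h2⟩
    | succ k ih =>
      obtain ⟨a, b, c⟩ := ih
      have h := hf ((k : ℤ) + 3)
      rw [show (k : ℤ) + 3 - 1 = k + 2 by ring, show (k : ℤ) + 3 - 2 = k + 1 by ring,
        show (k : ℤ) + 3 - 3 = k by ring] at h
      rw [show (k : ℤ) + 1 + 1 = k + 2 by ring, show (k : ℤ) + 1 + 2 = k + 3 by ring]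
      exact ⟨b, c, by linarith⟩
    | pred k ih =>
      obtain ⟨a, b, c⟩ := ih
      have h := hf (-(k : ℤ) + 2)
      rw [show -(k : ℤ) + 2 - 1 = -k + 1 by ring, show -(k : ℤ) + 2 - 2 = -k by ring,
        show -(k : ℤ) + 2 - 3 = -k - 1 by ring] at h
      rw [show -(k : ℤ) - 1 + 1 = -k by ring, show -(k : ℤ) - 1 + 2 = -k + 1 by ring]
      exact ⟨by linarith, a, b⟩
  exact (key n).1

theorem tribonacci_lucas_matrix_relations
    (𝒯 : ℤ → Matrix (Fin 3) (Fin 3) ℤ)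
    (h𝒯 : ∀ n : ℤ, 𝒯 n = 𝒯 (n - 1) + 𝒯 (n - 2) + 𝒯 (n - 3))
    (h𝒯0 : 𝒯 0 = 1)
    (h𝒯1 : 𝒯 1 = !![1, 1, 1; 1, 0, 0; 0, 1, 0])
    (h𝒯2 : 𝒯 2 = !![2, 2, 1; 1, 1, 1; 1, 0, 0])
    (𝒦 : ℤ → Matrix (Fin 3) (Fin 3) ℤ)
    (h𝒦 : ∀ n : ℤ, 𝒦 n = 𝒦 (n - 1) + 𝒦 (n - 2) + 𝒦 (n - 3))
    (h𝒦0 : 𝒦 0 = !![1, 2, 3; 3, -2, -1; -1, 4, -1])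
    (h𝒦1 : 𝒦 1 = !![3, 4, 1; 1, 2, 3; 3, -2, -1])
    (h𝒦2 : 𝒦 2 = !![7, 4, 3; 3, 4, 1; 1, 2, 3]) :
    ∀ n : ℤ,
      (𝒦 n = 3 • 𝒯 (n + 1) - 2 • 𝒯 n - 𝒯 (n - 1)) ∧
      (𝒦 n = 𝒯 n + 2 • 𝒯 (n - 1) + 3 • 𝒯 (n - 2)) ∧
      (𝒦 n = 4 • 𝒯 (n + 1) - 𝒯 n - 𝒯 (n + 2)) ∧
      (22 • 𝒯 n = 5 • 𝒦 (n + 2) - 3 • 𝒦 (n + 1) - 4 • 𝒦 n) := by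
  have rT : ∀ (n : ℤ) (i j : Fin 3),
      𝒯 n i j = 𝒯 (n - 1) i j + 𝒯 (n - 2) i j + 𝒯 (n - 3) i j := fun n i j => by
    conv_lhs => rw [h𝒯 n]
    simp
  have rK : ∀ (n : ℤ) (i j : Fin 3),
      𝒦 n i j = 𝒦 (n - 1) i j + 𝒦 (n - 2) i j + 𝒦 (n - 3) i j := fun n i j => by
    conv_lhs => rw [h𝒦 n]
    simp
  -- everything in terms of three consecutive Tribonacci matrices
  have key : ∀ (n : ℤ) (i j : Fin 3),
      𝒦 n i j = 𝒯 n i j + 2 * 𝒯 (n - 1) i j + 3 * 𝒯 (n - 2) i j := by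
    intro n i j
    have tm1 : 𝒯 (-1) i j = 𝒯 2 i j - 𝒯 1 i j - 𝒯 0 i j := by
      have := rT 2 i j
      norm_num at this
      linarith
    have tm2 : 𝒯 (-2) i j = 𝒯 1 i j - 𝒯 0 i j - 𝒯 (-1) i j := by
      have := rT 1 i j
      norm_num at this
      linarith
    have := trib_zero
      (fun n => 𝒦 n i j - (𝒯 n i j + 2 * 𝒯 (n - 1) i j + 3 * 𝒯 (n - 2) i j))
      (fun n => by
        have a := rK n i j
        have b := rT n i j
        have c := rT (n - 1) i j
        have d := rT (n - 2) i j
        ring_nf at a b c d ⊢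
        linarith)
      (by
        norm_num
        rw [tm2, tm1, h𝒯0, h𝒯1, h𝒯2, h𝒦0]
        fin_cases i <;> fin_cases j <;> simp)
      (by
        norm_num
        rw [tm1, h𝒯0, h𝒯1, h𝒯2, h𝒦1]
        fin_cases i <;> fin_cases j <;> simp)
      (by
        norm_num
        rw [h𝒯0, h𝒯1, h𝒯2, h𝒦2]
        fin_cases i <;> fin_cases j <;> simp) n
    linarith
  intro n
  refine ⟨?_, ?_, ?_, ?_⟩ <;> ext i j <;>
    simp only [Matrix.add_apply, Matrix.sub_apply, Matrix.smul_apply] <;>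
    simp only [nsmul_eq_mul] <;>
    push_cast <;>
    (have k0 := key n i j
     have k1 := key (n + 1) i j
     have k2 := key (n + 2) i j
     have t1 := rT (n + 1) i j
     have t2 := rT (n + 2) i j
     ring_nf at k0 k1 k2 t1 t2 ⊢
     linarith)
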